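/- arXiv:2005.06573 — 4 statements merged into one kernel-verified Lean document; each statement's English description precedes it below -/
import Mathlib

section
/- Suppose the null hypothesis holds, i.e. μ is the product of its d marginals, and let T : 𝒳^n → ℝ be any measurable statistic. Let ψ_2, …, ψ_{B+1} be i.i.d. permutation vectors, each consisting of d−1 independent permutations drawn uniformly from the symmetric group S_n, independent of D. Define the conservative p-value p̂ = (1 + #{i ∈ {2,…,B+1} : T(ψ_i D) ≥ T(D)})/(B+1). Then for every α ∈ [0,1], the probability that p̂ ≤ α is at most α; i.e. the permutation test based on a finite sample of B permutation vectors has correct type 1 error rate. -/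
open MeasureTheory ProbabilityTheory Filter
open scoped ENNReal Classical

instance (n : ℕ) : MeasurableSpace (Equiv.Perm (Fin n)) := ⊤

/-- The uniform distribution on the symmetric group `S_n`. -/
noncomputable def uniformPerm (n : ℕ) : Measure (Equiv.Perm (Fin n)) :=
  (PMF.uniformOfFintype (Equiv.Perm (Fin n))).toMeasure

/-- The action of a permutation vector `ψ = (ψ^1, …, ψ^{d-1})` on a dataset:
the first coordinate is kept fixed and coordinate `j+1` is permuted by `ψ^j`. -/
def permAct {d n : ℕ} {𝒳 : Fin d → Type*} (ψ : Fin (d-1) → Equiv.Perm (Fin n))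
    (D : Fin n → ∀ j, 𝒳 j) : Fin n → ∀ j, 𝒳 j :=
  fun i j => if h : j.val = 0 then D i j
    else D ((ψ ⟨j.val - 1, by have := j.isLt; omega⟩) i) j

/-- At most `c` indices of a finite real family have rank from the top at most `c`. -/
lemma card_filter_rank_le {ι : Type*} [Fintype ι] (t : ι → ℝ) {c : ℝ} (hc : 0 ≤ c) :
    ((Finset.univ.filter fun k : ι =>
      ((Finset.univ.filter fun i : ι => t i ≥ t k).card : ℝ) ≤ c).card : ℝ) ≤ c := by
  set K := Finset.univ.filter fun k : ι =>
    ((Finset.univ.filter fun i : ι => t i ≥ t k).card : ℝ) ≤ c with hK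
  rcases K.eq_empty_or_nonempty with hempty | hne
  · simpa [hempty] using hc
  · obtain ⟨k, hk, hmin⟩ := K.exists_min_image t hne
    have hsub : K ⊆ Finset.univ.filter fun i : ι => t i ≥ t k := fun i hi => by
      simpa using hmin i hi
    calc (K.card : ℝ) ≤ ((Finset.univ.filter fun i : ι => t i ≥ t k).card : ℝ) := by
          exact_mod_cast Finset.card_le_card hsub
      _ ≤ c := by
          rw [hK, Finset.mem_filter] at hk
          exact hk.2

lemma measurable_card_filter_ge {Ω ι : Type*} [MeasurableSpace Ω] [Fintype ι]
    {f : ι → Ω → ℝ} {g : Ω → ℝ} (hf : ∀ i, Measurable (f i)) (hg : Measurable g) :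
    Measurable fun ω => ((Finset.univ.filter fun i : ι => f i ω ≥ g ω).card : ℝ) := by
  simp_rw [Finset.card_filter, Nat.cast_sum]
  refine Finset.measurable_fun_sum _ fun i _ => ?_
  simp_rw [Nat.cast_ite]
  exact Measurable.ite (measurableSet_le hg (hf i)) measurable_const measurable_const

/-- An i.i.d. family is exchangeable. -/
lemma measurePreserving_pi_comp_perm {ι G : Type*} [Fintype ι] [MeasurableSpace G]
    (U : Measure G) [SigmaFinite U] (e : Equiv.Perm ι) :
    MeasurePreserving (fun (x : ι → G) i => x (e i))
      (Measure.pi fun _ => U) (Measure.pi fun _ => U) := by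
  refine ⟨by fun_prop, (Measure.pi_eq fun s hs => ?_).symm⟩
  rw [Measure.map_apply (by fun_prop) (MeasurableSet.univ_pi hs)]
  have hpre : (fun (x : ι → G) i => x (e i)) ⁻¹' Set.univ.pi s =
      Set.univ.pi fun i => s (e.symm i) := by
    ext x
    simp only [Set.mem_preimage, Set.mem_univ_pi]
    rw [← e.forall_congr_right (q := fun i => x i ∈ s (e.symm i))]
    simp
  rw [hpre, Measure.pi_pi, e.symm.prod_comp fun i => U (s i)]

/-- In an i.i.d. family, the normalized rank of a fixed member is stochastically at least
uniform. -/
lemma measure_pi_rank_le {ι G : Type*} [Fintype ι] [MeasurableSpace G]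
    (U : Measure G) [IsProbabilityMeasure U] {f : G → ℝ} (hf : Measurable f) (k₀ : ι)
    {α : ℝ} (hα : 0 ≤ α) :
    (Measure.pi fun _ : ι => U) {x | ((Finset.univ.filter
      fun i : ι => f (x i) ≥ f (x k₀)).card : ℝ) ≤ α * Fintype.card ι} ≤ ENNReal.ofReal α := by
  set c : ℝ := α * Fintype.card ι
  set E : ι → Set (ι → G) := fun k => {x | ((Finset.univ.filter
    fun i : ι => f (x i) ≥ f (x k)).card : ℝ) ≤ c} with hE
  have hc : 0 ≤ c := by positivity
  have hmeas (k : ι) : MeasurableSet (E k) :=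
    measurableSet_le (measurable_card_filter_ge (f := fun i (x : ι → G) => f (x i))
      (g := fun x => f (x k)) (fun i => by fun_prop) (by fun_prop)) measurable_const
  have hsymm (k : ι) : (Measure.pi fun _ : ι => U) (E k) = (Measure.pi fun _ : ι => U) (E k₀) := by
    rw [← (measurePreserving_pi_comp_perm U (Equiv.swap k₀ k)).measure_preimage
      (hmeas k₀).nullMeasurableSet]
    congr 1
    ext x
    simp only [hE, Set.mem_ofPred_eq, Set.mem_preimage, Equiv.swap_apply_left]
    rw [Finset.card_equiv (t := Finset.univ.filter fun i : ι => f (x (Equiv.swap k₀ k i)) ≥ f (x k))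
      (Equiv.swap k₀ k) (by simp)]
  have hsum : ∑ k, (Measure.pi fun _ : ι => U) (E k) ≤ ENNReal.ofReal c := by
    calc ∑ k, (Measure.pi fun _ : ι => U) (E k)
        = ∫⁻ x, ∑ k, (E k).indicator 1 x ∂(Measure.pi fun _ : ι => U) := by
          rw [lintegral_finsetSum _ fun k _ => measurable_one.indicator (hmeas k)]
          simp_rw [lintegral_indicator_one (hmeas _)]
      _ ≤ ∫⁻ _, ENNReal.ofReal c ∂(Measure.pi fun _ : ι => U) := by
          refine lintegral_mono fun x => ?_
          have hcard : ∑ k, (E k).indicator (1 : (ι → G) → ℝ≥0∞) x =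
              ((Finset.univ.filter fun k : ι => x ∈ E k).card : ℝ≥0∞) := by
            simp [Set.indicator_apply]
          rw [hcard, ← ENNReal.ofReal_natCast]
          exact ENNReal.ofReal_le_ofReal (card_filter_rank_le (fun i => f (x i)) hc)
      _ = ENNReal.ofReal c := by simp
  have : Nonempty ι := ⟨k₀⟩
  simp_rw [hsymm, Finset.sum_const, nsmul_eq_mul, Finset.card_univ] at hsum
  rw [show c = (Fintype.card ι : ℝ) * α from mul_comm _ _, ENNReal.ofReal_mul (by positivity),
    ENNReal.ofReal_natCast] at hsum
  exact (ENNReal.mul_le_mul_iff_right (by simp) (by simp)).1 hsum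

/-- An i.i.d. sample from a product measure is invariant in law under permuting each coordinate
separately. -/
lemma measurePreserving_pi_pi_perm {ι J : Type*} [Fintype ι] [Fintype J] {𝒳 : J → Type*}
    [∀ j, MeasurableSpace (𝒳 j)] (ν : ∀ j, Measure (𝒳 j)) [∀ j, IsProbabilityMeasure (ν j)]
    (σ : J → Equiv.Perm ι) :
    MeasurePreserving (fun (D : ι → ∀ j, 𝒳 j) i j => D (σ j i) j)
      (Measure.pi fun _ => Measure.pi ν) (Measure.pi fun _ => Measure.pi ν) := by
  have hmeas : Measurable fun (D : ι → ∀ j, 𝒳 j) i j => D (σ j i) j := by fun_prop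
  refine ⟨hmeas, (Measure.pi_eq_generateFrom (fun _ => generateFrom_pi)
    (fun _ => isPiSystem_pi) (fun _ => ⟨fun _ => Set.univ,
      fun _ => ⟨fun _ => Set.univ, by simp, by simp⟩, fun _ => measure_lt_top _ _,
      Set.iUnion_const _⟩) fun s hs => ?_).symm⟩
  choose t ht hts using hs
  obtain rfl : (fun i => Set.univ.pi (t i)) = s := funext hts
  have htm (i : ι) (j : J) : MeasurableSet (t i j) := ht i j (Set.mem_univ j)
  rw [Measure.map_apply hmeas
    (MeasurableSet.univ_pi fun i => MeasurableSet.univ_pi fun j => htm i j)]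
  have hpre : (fun (D : ι → ∀ j, 𝒳 j) i j => D (σ j i) j) ⁻¹'
      (Set.univ.pi fun i => Set.univ.pi (t i)) =
      Set.univ.pi fun i => Set.univ.pi fun j => t ((σ j).symm i) j := by
    ext D
    simp only [Set.mem_preimage, Set.mem_univ_pi]
    rw [forall_comm, forall_comm (α := ι)]
    refine forall_congr' fun j => ?_
    rw [← (σ j).forall_congr_right (q := fun i => D i j ∈ t ((σ j).symm i) j)]
    simp
  rw [hpre]
  simp_rw [Measure.pi_pi]
  rw [Finset.prod_comm, Finset.prod_comm (s := (Finset.univ : Finset ι))]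
  exact Finset.prod_congr rfl fun j _ => (σ j).symm.prod_comp fun i => ν j (t i j)

instance (n : ℕ) : DiscreteMeasurableSpace (Equiv.Perm (Fin n)) := ⟨fun _ => trivial⟩

instance (n : ℕ) : IsProbabilityMeasure (uniformPerm n) := by
  unfold uniformPerm
  infer_instance

lemma measurePreserving_mul_left_uniformPerm (n : ℕ) (g : Equiv.Perm (Fin n)) :
    MeasurePreserving (g * ·) (uniformPerm n) (uniformPerm n) := by
  refine ⟨.of_discrete, Measure.ext_of_singleton fun h => ?_⟩
  have hpre : (g * ·) ⁻¹' {h} = {g⁻¹ * h} := by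
    ext x
    simp [eq_inv_mul_iff_mul_eq]
  rw [Measure.map_apply .of_discrete (measurableSet_singleton h), hpre, uniformPerm,
    PMF.toMeasure_apply_singleton _ _ (measurableSet_singleton _),
    PMF.toMeasure_apply_singleton _ _ (measurableSet_singleton _),
    PMF.uniformOfFintype_apply, PMF.uniformOfFintype_apply]

lemma permAct_permAct {d n : ℕ} {𝒳 : Fin d → Type*} (φ ψ : Fin (d-1) → Equiv.Perm (Fin n))
    (D : Fin n → ∀ j, 𝒳 j) : permAct ψ (permAct φ D) = permAct (φ * ψ) D := by
  ext i j
  by_cases h : j.val = 0 <;> simp [permAct, h]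

lemma measurePreserving_permAct {d n : ℕ} {𝒳 : Fin d → Type*} [∀ j, MeasurableSpace (𝒳 j)]
    (ν : ∀ j, Measure (𝒳 j)) [∀ j, IsProbabilityMeasure (ν j)]
    (ψ : Fin (d-1) → Equiv.Perm (Fin n)) :
    MeasurePreserving (permAct (𝒳 := 𝒳) ψ)
      (Measure.pi fun _ => Measure.pi ν) (Measure.pi fun _ => Measure.pi ν) := by
  convert measurePreserving_pi_pi_perm ν
    (fun j => if h : j.val = 0 then 1 else ψ ⟨j.val - 1, by have := j.isLt; omega⟩) using 1
  ext D i j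
  by_cases h : j.val = 0 <;> simp [permAct, h]

lemma pvalue_le_iff {B : ℕ} (t : Fin (B + 1) → ℝ) (α : ℝ) :
    (1 + ((Finset.univ.filter fun i : Fin B => t i.succ ≥ t 0).card : ℝ)) / ((B : ℝ) + 1) ≤ α ↔
      ((Finset.univ.filter fun i : Fin (B + 1) => t i ≥ t 0).card : ℝ) ≤
        α * Fintype.card (Fin (B + 1)) := by
  rw [div_le_iff₀ (by positivity)]
  rw [Finset.card_filter, Finset.card_filter, Fin.sum_univ_succ]
  simp

/-- **Correct type 1 error rate of the permutation test using a finite sample of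
permutation vectors.**  Under the null hypothesis (the law `μ` of each observation is
the product of its `d` marginals), for any measurable statistic `T`, sampling
`B` i.i.d. permutation vectors `ψ_2, …, ψ_{B+1}` (each consisting of `d-1` independent
uniform permutations), independent of the i.i.d. sample `D`, the conservative `p`-value
`p̂ = (1 + #{i : T (ψ_i D) ≥ T D})/(B+1)` satisfies `P(p̂ ≤ α) ≤ α` for every
`α ∈ [0,1]`. -/
theorem type1_error_finite_sample_permutations
    {d n B : ℕ} (hd : 2 ≤ d) (hn : 1 ≤ n) (hB : 1 ≤ B)
    (𝒳 : Fin d → Type*) [∀ j, MeasurableSpace (𝒳 j)]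
    (μ : Measure (∀ j, 𝒳 j)) [IsProbabilityMeasure μ]
    (hnull : μ = Measure.pi (fun j => μ.map (fun x => x j)))
    (T : (Fin n → ∀ j, 𝒳 j) → ℝ) (hT : Measurable T)
    (α : ℝ) (hα : α ∈ Set.Icc (0:ℝ) 1) :
    ((Measure.pi fun _ : Fin n => μ).prod
        (Measure.pi fun _ : Fin B => Measure.pi fun _ : Fin (d-1) => uniformPerm n))
      {ω | ((1 + ((Finset.univ.filter
            (fun i : Fin B => T (permAct (ω.2 i) ω.1) ≥ T ω.1)).card : ℝ))
          / ((B : ℝ) + 1) ≤ α)}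
      ≤ ENNReal.ofReal α := by
  have hprob (j : Fin d) : IsProbabilityMeasure (μ.map fun x => x j) :=
    Measure.isProbabilityMeasure_map (measurable_pi_apply j).aemeasurable
  set P : Measure (Fin n → ∀ j, 𝒳 j) := Measure.pi fun _ : Fin n => μ with hP
  set U : Measure (Fin (d-1) → Equiv.Perm (Fin n)) :=
    Measure.pi fun _ : Fin (d-1) => uniformPerm n
  set V : Measure (Fin B → Fin (d-1) → Equiv.Perm (Fin n)) := Measure.pi fun _ : Fin B => U
  have hact (g : Fin (d-1) → Equiv.Perm (Fin n)) : MeasurePreserving (permAct g) P P := by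
    rw [hP, hnull]
    exact measurePreserving_permAct _ g
  have hmul (g : Fin (d-1) → Equiv.Perm (Fin n)) :
      MeasurePreserving (fun (ψ : Fin B → Fin (d-1) → Equiv.Perm (Fin n)) i => g * ψ i) V V :=
    measurePreserving_pi _ _ fun _ => measurePreserving_pi _ _ fun j =>
      measurePreserving_mul_left_uniformPerm n (g j)
  have hTact : Measurable fun p : (Fin n → ∀ j, 𝒳 j) × (Fin (d-1) → Equiv.Perm (Fin n)) =>
      T (permAct p.2 p.1) :=
    measurable_from_prod_countable_left fun g => hT.comp (hact g).measurable
  -- the rejection event with the observed dataset `D` replaced by `permAct g D`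
  set E : Set (((Fin (d-1) → Equiv.Perm (Fin n)) × (Fin n → ∀ j, 𝒳 j)) ×
      (Fin B → Fin (d-1) → Equiv.Perm (Fin n))) :=
    {ω | (1 + ((Finset.univ.filter
      fun i : Fin B => T (permAct (ω.2 i) ω.1.2) ≥ T (permAct ω.1.1 ω.1.2)).card : ℝ)) /
        ((B : ℝ) + 1) ≤ α} with hE
  have hEmeas : MeasurableSet E := by
    refine measurableSet_le (((measurable_card_filter_ge (fun i => ?_) ?_).const_add 1).div_const _)
      measurable_const
    · exact hTact.comp (g := fun p : (Fin n → ∀ j, 𝒳 j) × (Fin (d-1) → Equiv.Perm (Fin n)) =>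
        T (permAct p.2 p.1)) (by fun_prop :
          Measurable fun ω : ((Fin (d-1) → Equiv.Perm (Fin n)) × (Fin n → ∀ j, 𝒳 j)) ×
            (Fin B → Fin (d-1) → Equiv.Perm (Fin n)) => (ω.1.2, ω.2 i))
    · exact hTact.comp (by fun_prop :
          Measurable fun ω : ((Fin (d-1) → Equiv.Perm (Fin n)) × (Fin n → ∀ j, 𝒳 j)) ×
            (Fin B → Fin (d-1) → Equiv.Perm (Fin n)) => (ω.1.2, ω.1.1))
  set S : Set ((Fin n → ∀ j, 𝒳 j) × (Fin B → Fin (d-1) → Equiv.Perm (Fin n))) :=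
    {ω | ((1 + ((Finset.univ.filter
            (fun i : Fin B => T (permAct (ω.2 i) ω.1) ≥ T ω.1)).card : ℝ))
          / ((B : ℝ) + 1) ≤ α)} with hS
  have hpermAct_one (D : Fin n → ∀ j, 𝒳 j) : permAct 1 D = D := by
    ext i j
    simp [permAct]
  have hSmeas : MeasurableSet S := by
    have : S = (fun ω => ((1, ω.1), ω.2)) ⁻¹' E := by
      ext ω
      simp [hS, hE, hpermAct_one]
    rw [this]
    exact (by fun_prop : Measurable fun ω : (Fin n → ∀ j, 𝒳 j) ×
      (Fin B → Fin (d-1) → Equiv.Perm (Fin n)) =>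
        (((1 : Fin (d-1) → Equiv.Perm (Fin n)), ω.1), ω.2)) hEmeas
  have hinv (g : Fin (d-1) → Equiv.Perm (Fin n)) :
      (P.prod V) S = ∫⁻ D, V (Prod.mk (g, D) ⁻¹' E) ∂P := by
    rw [← ((hact g).prod (hmul g⁻¹)).measure_preimage hSmeas.nullMeasurableSet,
      Measure.prod_apply (((hact g).prod (hmul g⁻¹)).measurable hSmeas)]
    refine lintegral_congr fun D => ?_
    congr 1
    ext ψ
    simp [hS, hE, permAct_permAct]
  calc (P.prod V) S = ∫⁻ _, (P.prod V) S ∂U := by simp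
    _ = ∫⁻ g, ∫⁻ D, V (Prod.mk (g, D) ⁻¹' E) ∂P ∂U := lintegral_congr hinv
    _ = ∫⁻ D, ∫⁻ g, V (Prod.mk (g, D) ⁻¹' E) ∂U ∂P :=
        lintegral_lintegral_swap (measurable_measure_prodMk_left hEmeas).aemeasurable
    _ ≤ ∫⁻ _, ENNReal.ofReal α ∂P := by
        refine lintegral_mono fun D => ?_
        have hslice : MeasurableSet ((fun p : (Fin (d-1) → Equiv.Perm (Fin n)) ×
            (Fin B → Fin (d-1) → Equiv.Perm (Fin n)) => ((p.1, D), p.2)) ⁻¹' E) :=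
          .of_discrete
        have hprod := Measure.prod_apply (μ := U) (ν := V) hslice
        refine (hprod.symm.trans ?_).trans_le
          (measure_pi_rank_le U (.of_discrete (f := fun g => T (permAct g D)))
            (0 : Fin (B + 1)) hα.1)
        rw [← (measurePreserving_piFinSuccAbove (fun _ : Fin (B + 1) => U) 0).measure_preimage
          hslice.nullMeasurableSet]
        congr 1
        ext Ψ
        exact pvalue_le_iff (fun i => T (permAct (Ψ i) D)) α
    _ = ENNReal.ofReal α := by simp
end

section
/- Assume Assumption 1 holds. Let ψ^1 be the identity permutation of {1,…,n} and let ψ^2, …, ψ^d be i.i.d. permutations drawn uniformly from S_n, independent of the i.i.d. sample (X_1, …, X_n) from μ. Define A_n = n^{−2} Σ_{(i_1,i_2)∈{1..n}^2} Π_{j=1}^d k^j(X_{ψ^j(i_1)}^j, X_{ψ^j(i_2)}^j). Then lim_{n→∞} E[A_n] = Π_{j=1}^d ∫∫ k^j(x^j, y^j) dμ(x) dμ(y), i.e. the product over j of the expectation of k^j evaluated at the j-th coordinates of two independent draws from μ. -/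
open MeasureTheory ProbabilityTheory Filter
open scoped ENNReal Classical

/-- Extends a tuple `(ψ^2, …, ψ^d)` of permutations to indices `1, …, d` by letting
`ψ^1` be the identity permutation. -/
def fullPerm {d n : ℕ} (ψ : Fin (d-1) → Equiv.Perm (Fin n)) (j : Fin d) :
    Equiv.Perm (Fin n) :=
  if h : j.val = 0 then 1 else ψ ⟨j.val - 1, by have := j.isLt; omega⟩

/-- Assumption 1: there is a uniform bound `C` on `E |∏_j k^j(Y_{τ(2j-1)}, Y_{τ(2j)})|`
over all index maps `τ`, where `Y_1, …, Y_{2d}` are i.i.d. with law `μ`. -/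
def Assumption1 {d : ℕ} {𝒳 : Fin d → Type*} [∀ j, MeasurableSpace (𝒳 j)]
    (k : ∀ j, 𝒳 j → 𝒳 j → ℝ) (μ : Measure (∀ j, 𝒳 j)) : Prop :=
  ∃ C : ℝ, ∀ τ : Fin (2*d) → Fin (2*d),
    ∫⁻ Y in Set.univ, ENNReal.ofReal |∏ j : Fin d,
        k j (Y (τ ⟨2*j.val, by have := j.isLt; omega⟩) j)
            (Y (τ ⟨2*j.val+1, by have := j.isLt; omega⟩) j)|
      ∂(Measure.pi fun _ : Fin (2*d) => μ) ≤ ENNReal.ofReal C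

section IIDSample

variable {α β E : Type*} [Fintype α] [Fintype β] [MeasurableSpace E]
  (μ : Measure E) [IsProbabilityMeasure μ]

/-- Selecting distinct entries of an i.i.d. sample yields an i.i.d. sample. -/
lemma measurePreserving_pi_comp {ι : α → β} (hι : Function.Injective ι) :
    MeasurePreserving (fun (X : β → E) a => X (ι a))
      (Measure.pi fun _ => μ) (Measure.pi fun _ => μ) := by
  refine ⟨by fun_prop, ?_⟩
  have h := (iIndepFun_pi (μ := fun _ : β => μ) (X := fun _ => id)
    fun _ => aemeasurable_id).precomp hι
  have h' := h.map_fun_eq_pi_map fun a => (measurable_pi_apply (ι a)).aemeasurable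
  simpa [(measurePreserving_eval (fun _ : β => μ) _).map_eq] using h'

/-- The law of a subsample, possibly with repetitions, is that of a subsample of an
i.i.d. sample indexed by the subsample itself. -/
lemma exists_lintegral_pi_comp_eq (σ : α → β) :
    ∃ τ : α → α, ∀ F : (α → E) → ℝ≥0∞, Measurable F →
      ∫⁻ X, F (fun a => X (σ a)) ∂(Measure.pi fun _ => μ) =
        ∫⁻ Y, F (fun a => Y (τ a)) ∂(Measure.pi fun _ => μ) := by
  choose s hs using fun b : Set.range σ => b.2
  have hs_inj : Function.Injective s := fun b c h => Subtype.ext (by rw [← hs b, ← hs c, h])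
  refine ⟨fun a => s ⟨σ a, a, rfl⟩, fun F hF => ?_⟩
  have hG : Measurable fun Z : Set.range σ → E => F fun a => Z ⟨σ a, a, rfl⟩ := by fun_prop
  exact ((measurePreserving_pi_comp μ Subtype.val_injective).lintegral_comp hG).trans
    ((measurePreserving_pi_comp μ hs_inj).lintegral_comp hG).symm

/-- Pairing distinct entries of an i.i.d. sample yields an i.i.d. sample of pairs. -/
lemma measurePreserving_pi_pair {p q : α → β} (h : Function.Injective (Sum.elim p q)) :
    MeasurePreserving (fun (X : β → E) a => (X (p a), X (q a)))
      (Measure.pi fun _ => μ) (Measure.pi fun _ => μ.prod μ) :=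
  (measurePreserving_arrowProdEquivProdArrow E E α (fun _ => μ) (fun _ => μ)).symm.comp
    ((measurePreserving_sumPiEquivProdPi fun _ : α ⊕ α => μ).comp
      (measurePreserving_pi_comp μ h))

end IIDSample

section Kernels

variable {d n : ℕ} {𝒳 : Fin d → Type*} [∀ j, MeasurableSpace (𝒳 j)]
  {k : ∀ j, 𝒳 j → 𝒳 j → ℝ} {μ : Measure (∀ j, 𝒳 j)} [IsProbabilityMeasure μ]

lemma measurable_kernel_apply (hk : ∀ j, Measurable fun p : 𝒳 j × 𝒳 j => k j p.1 p.2) (j : Fin d) :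
    Measurable fun z : (∀ j, 𝒳 j) × (∀ j, 𝒳 j) => k j (z.1 j) (z.2 j) :=
  (hk j).comp (by fun_prop : Measurable fun z : (∀ j, 𝒳 j) × (∀ j, 𝒳 j) => (z.1 j, z.2 j))

lemma measurable_prod_kernel {β : Type*}
    (hk : ∀ j, Measurable fun p : 𝒳 j × 𝒳 j => k j p.1 p.2) (p q : Fin d → β) :
    Measurable fun X : β → ∀ j, 𝒳 j => ∏ j, k j (X (p j) j) (X (q j) j) :=
  Finset.measurable_fun_prod _ fun j _ => (measurable_kernel_apply hk j).comp
    (by fun_prop : Measurable fun X : β → ∀ j, 𝒳 j => (X (p j), X (q j)))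

/-- Assumption 1 bounds the kernel products along every choice of sample indices. -/
lemma Assumption1.exists_lintegral_le (hA1 : Assumption1 k μ)
    (hk : ∀ j, Measurable fun p : 𝒳 j × 𝒳 j => k j p.1 p.2) :
    ∃ C : ℝ, 0 ≤ C ∧ ∀ (n : ℕ) (p q : Fin d → Fin n),
      ∫⁻ X, ‖∏ j, k j (X (p j) j) (X (q j) j)‖ₑ ∂(Measure.pi fun _ => μ) ≤ ENNReal.ofReal C := by
  obtain ⟨C, hC⟩ := hA1
  refine ⟨max C 0, le_max_right _ _, fun n p q => ?_⟩
  let σ : Fin (2 * d) → Fin n := fun a =>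
    if a.val % 2 = 0 then p ⟨a.val / 2, by omega⟩ else q ⟨a.val / 2, by omega⟩
  obtain ⟨τ, hτ⟩ := exists_lintegral_pi_comp_eq μ σ
  let e : Fin d → Fin (2 * d) := fun j => ⟨2 * j.val, by omega⟩
  let o : Fin d → Fin (2 * d) := fun j => ⟨2 * j.val + 1, by omega⟩
  have key := hτ (fun Y => ‖∏ j, k j (Y (e j) j) (Y (o j) j)‖ₑ)
    (measurable_prod_kernel hk e o).enorm
  have hσp (j : Fin d) : σ (e j) = p j := by simp [σ, e]
  have hσq (j : Fin d) : σ (o j) = q j := by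
    simp [σ, o, Nat.add_mod, show (2 * j.val + 1) / 2 = j.val by omega]
  simp only [hσp, hσq] at key
  rw [key]
  refine le_trans ?_ ((hC τ).trans (ENNReal.ofReal_le_ofReal (le_max_left _ _)))
  simp only [Measure.restrict_univ, ← Real.norm_eq_abs, ofReal_norm]
  exact le_rfl

/-- If the product of the `f j` at independent pairs is integrable, then the products of the
double integrals and of the iterated integrals agree, even if some `f j` is not integrable. -/
lemma prod_integral_prod_eq {ι E : Type*} [Fintype ι] [MeasurableSpace E] {μ : Measure E}
    [IsProbabilityMeasure μ] {f : ι → E → E → ℝ}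
    (hf : ∀ j, Measurable fun z : E × E => f j z.1 z.2)
    (hfin : ∫⁻ Z, ‖∏ j, f j (Z j).1 (Z j).2‖ₑ ∂(Measure.pi fun _ : ι => μ.prod μ) ≠ ∞) :
    ∏ j, ∫ z, f j z.1 z.2 ∂(μ.prod μ) = ∏ j, ∫ x, ∫ y, f j x y ∂μ ∂μ := by
  have hmeas (j : ι) : Measurable fun z : E × E => ‖f j z.1 z.2‖ₑ := (hf j).enorm
  have hprod : ∫⁻ Z, ‖∏ j, f j (Z j).1 (Z j).2‖ₑ ∂(Measure.pi fun _ : ι => μ.prod μ) =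
      ∏ j, ∫⁻ z, ‖f j z.1 z.2‖ₑ ∂(μ.prod μ) := by
    have hindep := iIndepFun_pi (μ := fun _ : ι => μ.prod μ)
      (X := fun j z => ‖f j z.1 z.2‖ₑ) fun j => (hmeas j).aemeasurable
    simp only [enorm_eq_nnnorm, nnnorm_prod, ENNReal.ofNNReal_finsetProd] at hindep hmeas ⊢
    rw [lintegral_prod_eq_prod_lintegral_of_indepFun _ _ hindep
      fun j => (hmeas j).comp (measurable_pi_apply j)]
    exact Finset.prod_congr rfl fun j _ =>
      (measurePreserving_eval (fun _ : ι => μ.prod μ) j).lintegral_comp (hmeas j)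
  rw [hprod] at hfin
  by_cases hzero : ∃ j, ∫⁻ z, ‖f j z.1 z.2‖ₑ ∂(μ.prod μ) = 0
  · obtain ⟨j, hj⟩ := hzero
    have hae : ∀ᵐ z ∂(μ.prod μ), f j z.1 z.2 = 0 := by
      filter_upwards [(lintegral_eq_zero_iff (hmeas j)).1 hj] with z hz
      simpa using hz
    rw [Finset.prod_eq_zero (Finset.mem_univ j) (integral_eq_zero_of_ae hae),
      Finset.prod_eq_zero (Finset.mem_univ j)]
    refine integral_eq_zero_of_ae ?_
    filter_upwards [Measure.ae_ae_of_ae_prod hae] with x hx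
    exact integral_eq_zero_of_ae hx
  · push Not at hzero
    refine Finset.prod_congr rfl fun j _ => integral_prod _ ⟨(hf j).aestronglyMeasurable, ?_⟩
    rw [HasFiniteIntegral, lt_top_iff_ne_top]
    intro htop
    refine hfin ?_
    rw [← Finset.mul_prod_erase _ _ (Finset.mem_univ j), htop,
      ENNReal.top_mul (Finset.prod_ne_zero_iff.2 fun i _ => hzero i)]

/-- Along pairwise distinct sample indices the kernel product has expectation `ζ`. -/
lemma integral_prod_kernel_eq (hk : ∀ j, Measurable fun p : 𝒳 j × 𝒳 j => k j p.1 p.2)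
    {p q : Fin d → Fin n} (hpq : Function.Injective (Sum.elim p q))
    (hfin : ∫⁻ X, ‖∏ j, k j (X (p j) j) (X (q j) j)‖ₑ ∂(Measure.pi fun _ => μ) ≠ ∞) :
    ∫ X, ∏ j, k j (X (p j) j) (X (q j) j) ∂(Measure.pi fun _ => μ) =
      ∏ j, ∫ x, ∫ y, k j (x j) (y j) ∂μ ∂μ := by
  have hmp := measurePreserving_pi_pair μ hpq
  have hmeas : Measurable fun Z : Fin d → (∀ j, 𝒳 j) × (∀ j, 𝒳 j) =>
      ∏ j, k j ((Z j).1 j) ((Z j).2 j) :=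
    Finset.measurable_fun_prod _ fun j _ =>
      (measurable_kernel_apply hk j).comp (measurable_pi_apply j)
  have hzeta := prod_integral_prod_eq (μ := μ) (f := fun j x y => k j (x j) (y j))
    (measurable_kernel_apply hk)
  rw [← hzeta]
  · rw [← integral_fintype_prod_eq_prod
      (f := fun j (z : (∀ j, 𝒳 j) × (∀ j, 𝒳 j)) => k j (z.1 j) (z.2 j)), ← hmp.map_eq,
      integral_map hmp.measurable.aemeasurable hmeas.aestronglyMeasurable]
  · rwa [← hmp.lintegral_comp hmeas.enorm]

end Kernels

section UniformPermutations

variable {d n : ℕ}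

instance instDiscreteMeasurableSpacePermFin (n : ℕ) :
    DiscreteMeasurableSpace (Equiv.Perm (Fin n)) := ⟨fun _ => trivial⟩

instance instIsProbabilityMeasureUniformPerm (n : ℕ) : IsProbabilityMeasure (uniformPerm n) := by
  unfold uniformPerm; infer_instance

instance instIsMulLeftInvariantUniformPerm (n : ℕ) : (uniformPerm n).IsMulLeftInvariant := by
  refine ⟨fun g => Measure.ext_of_singleton fun σ => ?_⟩
  have hpre : (fun x => g * x) ⁻¹' {σ} = {g⁻¹ * σ} := by
    ext x; simp [eq_inv_mul_iff_mul_eq]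
  rw [Measure.map_apply (measurable_const_mul g) (measurableSet_singleton σ), hpre]
  simp [uniformPerm]

lemma fullPerm_mulSingle_mul (a : Fin (d - 1)) (g : Equiv.Perm (Fin n))
    (ψ : Fin (d - 1) → Equiv.Perm (Fin n)) (j : Fin d) :
    fullPerm (Pi.mulSingle a g * ψ) j =
      (if j.val = a.val + 1 then g else 1) * fullPerm ψ j := by
  unfold fullPerm
  by_cases hj : j.val = 0
  · simp [hj]
  · have : (⟨j.val - 1, by omega⟩ : Fin (d - 1)) = a ↔ j.val = a.val + 1 := by
      rw [Fin.ext_iff]; simp only; omega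
    simp [hj, Pi.mulSingle_apply, this]

/-- Two different permutations of the tuple collide with probability at most `1 / n`. -/
lemma measureReal_fullPerm_eq_le [NeZero n] {j l : Fin d} (hjl : j ≠ l) (s t : Fin n) :
    (Measure.pi fun _ : Fin (d - 1) => uniformPerm n).real
      {ψ | fullPerm ψ j s = fullPerm ψ l t} ≤ 1 / n := by
  wlog hj : j.val ≠ 0 generalizing j l s t
  · have := this hjl.symm t s (fun hl => hjl (Fin.ext (by omega)))
    simpa only [eq_comm] using this
  set P := Measure.pi fun _ : Fin (d - 1) => uniformPerm n
  let S : Fin n → Set (Fin (d - 1) → Equiv.Perm (Fin n)) := fun c =>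
    {ψ | fullPerm ψ j s + c = fullPerm ψ l t}
  have hS (c : Fin n) : P.real (S c) = P.real {ψ | fullPerm ψ j s = fullPerm ψ l t} := by
    let a : Fin (d - 1) := ⟨j.val - 1, by omega⟩
    have hpre : (fun ψ => Pi.mulSingle a (Equiv.addRight c) * ψ) ⁻¹'
        {ψ | fullPerm ψ j s = fullPerm ψ l t} = S c := by
      have ha : j.val = a.val + 1 := by simp only [a]; omega
      have hl : ¬ l.val = a.val + 1 := fun h => hjl (Fin.ext (by omega))
      ext ψ
      simp only [Set.mem_preimage, Set.mem_ofPred_eq, fullPerm_mulSingle_mul, if_pos ha, if_neg hl, S]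
      simp
    rw [← hpre, measureReal_def, measure_preimage_mul, measureReal_def]
  have hdisj : Pairwise (Function.onFun Disjoint S) := fun c c' hc =>
    Set.disjoint_left.2 fun ψ h h' => hc (add_left_cancel (h.trans h'.symm))
  have hsum : ∑ c, P.real (S c) ≤ 1 := by
    rw [← measureReal_iUnion_fintype hdisj fun _ => .of_discrete]
    exact measureReal_le_one
  simp only [hS, Finset.sum_const, Finset.card_univ, Fintype.card_fin, nsmul_eq_mul] at hsum
  rw [le_div_iff₀ (by exact_mod_cast NeZero.pos n), mul_comm]
  exact hsum

/-- The permuted images of two distinct indices are pairwise distinct with high probability. -/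
lemma measureReal_not_injective_le [NeZero n] {s t : Fin n} (hst : s ≠ t) :
    (Measure.pi fun _ : Fin (d - 1) => uniformPerm n).real
      {ψ | ¬ Function.Injective
        (Sum.elim (fun j : Fin d => fullPerm ψ j s) fun j => fullPerm ψ j t)} ≤
      4 * (d : ℝ) ^ 2 / n := by
  let u : Bool → Fin n := fun b => cond b s t
  let S : (Fin d × Fin d) × (Bool × Bool) → Set (Fin (d - 1) → Equiv.Perm (Fin n)) := fun x =>
    {ψ | x.1.1 ≠ x.1.2 ∧ fullPerm ψ x.1.1 (u x.2.1) = fullPerm ψ x.1.2 (u x.2.2)}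
  have hsub : {ψ : Fin (d - 1) → Equiv.Perm (Fin n) | ¬ Function.Injective
      (Sum.elim (fun j : Fin d => fullPerm ψ j s) fun j => fullPerm ψ j t)} ⊆ ⋃ x, S x := by
    intro ψ hψ
    contrapose! hψ
    simp only [Set.mem_iUnion, S, Set.mem_ofPred_eq, not_exists, not_and] at hψ
    have huniq (j l : Fin d) (b c : Bool) (h : fullPerm ψ j (u b) = fullPerm ψ l (u c)) :
        j = l := by
      by_contra hjl
      exact hψ ((j, l), (b, c)) hjl h
    simp only [Set.mem_ofPred_eq, not_not]
    rintro (j | j) (l | l) h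
    · rw [huniq j l true true h]
    · obtain rfl := huniq j l true false h
      exact absurd ((fullPerm ψ j).injective h) hst
    · obtain rfl := huniq j l false true h
      exact absurd ((fullPerm ψ j).injective h).symm hst
    · rw [huniq j l false false h]
  calc _ ≤ (Measure.pi fun _ : Fin (d - 1) => uniformPerm n).real (⋃ x, S x) :=
        measureReal_mono hsub
    _ ≤ ∑ x, (Measure.pi fun _ : Fin (d - 1) => uniformPerm n).real (S x) :=
        measureReal_iUnion_fintype_le _
    _ ≤ ∑ _x : (Fin d × Fin d) × (Bool × Bool), (1 / n : ℝ) := by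
        refine Finset.sum_le_sum fun x _ => ?_
        by_cases hx : x.1.1 = x.1.2
        · simp [S, hx]
        · exact (measureReal_mono fun ψ hψ => hψ.2).trans (measureReal_fullPerm_eq_le hx _ _)
    _ = 4 * (d : ℝ) ^ 2 / n := by
        simp only [Finset.sum_const, Finset.card_univ, Fintype.card_prod, Fintype.card_fin,
          Fintype.card_bool, nsmul_eq_mul]
        push_cast
        ring

end UniformPermutations

lemma integrable_prod_of_finite {Ω S : Type*} [MeasurableSpace Ω] [MeasurableSpace S] [Finite S]
    [DiscreteMeasurableSpace S] {ν : Measure Ω} [IsProbabilityMeasure ν] {P : Measure S}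
    [IsProbabilityMeasure P] {f : Ω → S → ℝ} (hf : ∀ s, Integrable (f · s) ν)
    (hm : ∀ s, Measurable (f · s)) :
    Integrable (fun ω : Ω × S => f ω.1 ω.2) (ν.prod P) := by
  have hmeas : Measurable fun ω : Ω × S => f ω.1 ω.2 := measurable_from_prod_countable_left hm
  exact (integrable_prod_iff' hmeas.aestronglyMeasurable).2
    ⟨.of_forall hf, .of_finite⟩

section PermutedSample

variable {d n : ℕ} {𝒳 : Fin d → Type*} [∀ j, MeasurableSpace (𝒳 j)]
  {k : ∀ j, 𝒳 j → 𝒳 j → ℝ} {μ : Measure (∀ j, 𝒳 j)} [IsProbabilityMeasure μ]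

lemma integrable_prod_kernel_fullPerm
    (hk : ∀ j, Measurable fun p : 𝒳 j × 𝒳 j => k j p.1 p.2) {C : ℝ}
    (hC : ∀ (n : ℕ) (p q : Fin d → Fin n), ∫⁻ X, ‖∏ j, k j (X (p j) j) (X (q j) j)‖ₑ
      ∂(Measure.pi fun _ => μ) ≤ ENNReal.ofReal C) (s t : Fin n) :
    Integrable (fun ω : (Fin n → ∀ j, 𝒳 j) × (Fin (d - 1) → Equiv.Perm (Fin n)) =>
        ∏ j : Fin d, k j (ω.1 (fullPerm ω.2 j s) j) (ω.1 (fullPerm ω.2 j t) j))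
      ((Measure.pi fun _ : Fin n => μ).prod (Measure.pi fun _ : Fin (d - 1) => uniformPerm n)) :=
  integrable_prod_of_finite
    (f := fun (X : Fin n → ∀ j, 𝒳 j) (ψ : Fin (d - 1) → Equiv.Perm (Fin n)) =>
      ∏ j : Fin d, k j (X (fullPerm ψ j s) j) (X (fullPerm ψ j t) j))
    (fun _ => ⟨(measurable_prod_kernel hk _ _).aestronglyMeasurable,
      (hC n _ _).trans_lt ENNReal.ofReal_lt_top⟩)
    fun _ => measurable_prod_kernel hk _ _

/-- The expectation of a summand of `A_n` is close to `ζ` off the diagonal. -/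
lemma norm_integral_fullPerm_sub_le [NeZero n]
    (hk : ∀ j, Measurable fun p : 𝒳 j × 𝒳 j => k j p.1 p.2) {C : ℝ} (hC0 : 0 ≤ C)
    (hC : ∀ (n : ℕ) (p q : Fin d → Fin n), ∫⁻ X, ‖∏ j, k j (X (p j) j) (X (q j) j)‖ₑ
      ∂(Measure.pi fun _ => μ) ≤ ENNReal.ofReal C) (s t : Fin n) :
    ‖(∫ ω, ∏ j : Fin d, k j (ω.1 (fullPerm ω.2 j s) j) (ω.1 (fullPerm ω.2 j t) j)
        ∂((Measure.pi fun _ : Fin n => μ).prod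
          (Measure.pi fun _ : Fin (d - 1) => uniformPerm n))) -
      ∏ j : Fin d, ∫ x, ∫ y, k j (x j) (y j) ∂μ ∂μ‖ ≤
      (C + |∏ j : Fin d, ∫ x, ∫ y, k j (x j) (y j) ∂μ ∂μ|) *
        (4 * (d : ℝ) ^ 2 / n + if s = t then 1 else 0) := by
  set ζ := ∏ j : Fin d, ∫ x, ∫ y, k j (x j) (y j) ∂μ ∂μ
  set P := Measure.pi fun _ : Fin (d - 1) => uniformPerm n
  let B : Set (Fin (d - 1) → Equiv.Perm (Fin n)) := {ψ | ¬ Function.Injective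
    (Sum.elim (fun j : Fin d => fullPerm ψ j s) fun j => fullPerm ψ j t)}
  have hB : P.real B ≤ 4 * (d : ℝ) ^ 2 / n + if s = t then 1 else 0 := by
    split_ifs with hst
    · exact measureReal_le_one.trans (le_add_of_nonneg_left (by positivity))
    · rw [add_zero]
      exact measureReal_not_injective_le hst
  have hbound (ψ : Fin (d - 1) → Equiv.Perm (Fin n)) :
      ‖(∫ X, ∏ j : Fin d, k j (X (fullPerm ψ j s) j) (X (fullPerm ψ j t) j)
        ∂(Measure.pi fun _ : Fin n => μ)) - ζ‖ ≤ B.indicator (fun _ => C + |ζ|) ψ := by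
    have hle := hC n (fun j => fullPerm ψ j s) (fun j => fullPerm ψ j t)
    by_cases hψ : ψ ∈ B
    · rw [Set.indicator_of_mem hψ]
      refine (norm_sub_le _ _).trans (add_le_add ?_ le_rfl)
      rw [← ENNReal.ofReal_le_ofReal_iff hC0, ofReal_norm]
      exact (enorm_integral_le_lintegral_enorm _).trans hle
    · rw [Set.indicator_of_notMem hψ, integral_prod_kernel_eq hk (not_not.1 hψ)
        (hle.trans_lt ENNReal.ofReal_lt_top).ne, sub_self, norm_zero]
  rw [integral_prod_symm _ (integrable_prod_kernel_fullPerm hk hC s t)]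
  calc _ = ‖∫ ψ, ((∫ X, ∏ j : Fin d, k j (X (fullPerm ψ j s) j) (X (fullPerm ψ j t) j)
        ∂(Measure.pi fun _ : Fin n => μ)) - ζ) ∂P‖ := by
        rw [integral_sub .of_finite (integrable_const ζ)]
        simp [P]
    _ ≤ ∫ ψ, B.indicator (fun _ => C + |ζ|) ψ ∂P :=
        norm_integral_le_of_norm_le .of_finite (.of_forall hbound)
    _ = (C + |ζ|) * P.real B := by
        rw [integral_indicator_const _ .of_discrete, smul_eq_mul, mul_comm]
    _ ≤ _ := mul_le_mul_of_nonneg_left hB (by positivity)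

end PermutedSample

/-- **Convergence of the expectation of the first term `A_n` of the permuted dHSIC
statistic.**  Under Assumption 1, with `ψ^1` the identity permutation and
`ψ^2, …, ψ^d` i.i.d. uniform permutations independent of the i.i.d. sample
`(X_1, …, X_n)` from `μ`, the expectation of
`A_n = n^{-2} Σ_{(i_1,i_2)} ∏_j k^j(X^j_{ψ^j(i_1)}, X^j_{ψ^j(i_2)})`
converges to `ζ = ∏_j E[k^j(X^j, X̃^j)]`, the product over `j` of the expectation of
`k^j` at the `j`-th coordinates of two independent draws from `μ`. -/
theorem expectation_An_tendsto_zeta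
    {d : ℕ} (hd : 2 ≤ d)
    (𝒳 : Fin d → Type*) [∀ j, MeasurableSpace (𝒳 j)]
    (k : ∀ j, 𝒳 j → 𝒳 j → ℝ)
    (hk : ∀ j, Measurable (fun p : 𝒳 j × 𝒳 j => k j p.1 p.2))
    (μ : Measure (∀ j, 𝒳 j)) [IsProbabilityMeasure μ]
    (hA1 : Assumption1 k μ) :
    Tendsto (fun n : ℕ =>
        ∫ ω, (1/(n:ℝ)^2) * ∑ i : Fin n × Fin n, ∏ j : Fin d,
            k j (ω.1 (fullPerm ω.2 j i.1) j) (ω.1 (fullPerm ω.2 j i.2) j)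
          ∂((Measure.pi fun _ : Fin n => μ).prod
              (Measure.pi fun _ : Fin (d-1) => uniformPerm n)))
      atTop (nhds (∏ j : Fin d, ∫ x, ∫ y, k j (x j) (y j) ∂μ ∂μ)) := by
  obtain ⟨C, hC0, hC⟩ := hA1.exists_lintegral_le hk
  set ζ := ∏ j : Fin d, ∫ x, ∫ y, k j (x j) (y j) ∂μ ∂μ
  refine tendsto_iff_norm_sub_tendsto_zero.2 (squeeze_zero' (.of_forall fun _ => norm_nonneg _)
    (eventually_atTop.2 ⟨1, fun n hn => ?_⟩)
    (tendsto_const_div_atTop_nhds_zero_nat ((C + |ζ|) * (4 * (d : ℝ) ^ 2 + 1))))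
  have : NeZero n := ⟨by omega⟩
  have hn0 : (0 : ℝ) < n := by exact_mod_cast hn
  have hint (i : Fin n × Fin n) := integrable_prod_kernel_fullPerm hk hC i.1 i.2
  rw [integral_const_mul, integral_finsetSum _ fun i _ => hint i]
  have hζ : ζ = 1 / (n : ℝ) ^ 2 * ∑ _i : Fin n × Fin n, ζ := by
    simp only [Finset.sum_const, Finset.card_univ, Fintype.card_prod, Fintype.card_fin,
      nsmul_eq_mul, Nat.cast_mul]
    field_simp
  rw [hζ, ← mul_sub, ← Finset.sum_sub_distrib, norm_mul,
    Real.norm_of_nonneg (by positivity : 0 ≤ 1 / (n : ℝ) ^ 2)]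
  have hsum : ‖∑ i : Fin n × Fin n, ((∫ ω, ∏ j : Fin d,
      k j (ω.1 (fullPerm ω.2 j i.1) j) (ω.1 (fullPerm ω.2 j i.2) j)
        ∂((Measure.pi fun _ : Fin n => μ).prod
          (Measure.pi fun _ : Fin (d-1) => uniformPerm n))) - ζ)‖ ≤
      ∑ i : Fin n × Fin n, (C + |ζ|) * (4 * (d : ℝ) ^ 2 / n + if i.1 = i.2 then 1 else 0) :=
    norm_sum_le_of_le _ fun i _ => norm_integral_fullPerm_sub_le hk hC0 hC i.1 i.2
  refine (mul_le_mul_of_nonneg_left hsum (by positivity)).trans_eq ?_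
  rw [← Finset.mul_sum, Finset.sum_add_distrib, Fintype.sum_prod_type
    (f := fun i : Fin n × Fin n => if i.1 = i.2 then (1 : ℝ) else 0)]
  simp only [Finset.sum_const, Finset.card_univ, Fintype.card_prod, Fintype.card_fin,
    nsmul_eq_mul, Nat.cast_mul, Finset.sum_ite_eq, Finset.mem_univ, if_true, mul_one]
  field_simp
end

section
/- Assume Assumption 1 holds. Let ψ = (ψ^1, …, ψ^{d−1}) be a vector of d−1 i.i.d. permutations drawn uniformly from S_n, independent of the i.i.d. sample D = (X_1, …, X_n) from μ (μ arbitrary). Then the expectation of the permuted statistic converges to zero: lim_{n→∞} E[dHSIĈ(ψD)] = 0. -/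
open MeasureTheory ProbabilityTheory Filter
open scoped ENNReal Classical

/-- The empirical dHSIC statistic of a dataset `(x_1, …, x_n)`, built from kernels
`k^1, …, k^d`. -/
noncomputable def dHSIC {d n : ℕ} {𝒳 : Fin d → Type*} (k : ∀ j, 𝒳 j → 𝒳 j → ℝ)
    (x : Fin n → ∀ j, 𝒳 j) : ℝ :=
  (1/(n:ℝ)^2) * ∑ i : Fin n × Fin n, ∏ j, k j (x i.1 j) (x i.2 j)
  + (1/(n:ℝ)^(2*d)) * ∑ i : Fin (2*d) → Fin n, ∏ j : Fin d,
      k j (x (i ⟨2*j.val, by have := j.isLt; omega⟩) j)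
          (x (i ⟨2*j.val+1, by have := j.isLt; omega⟩) j)
  - (2/(n:ℝ)^(d+1)) * ∑ i : Fin (d+1) → Fin n, ∏ j : Fin d,
      k j (x (i 0) j) (x (i j.succ) j)

/-- The position of the first argument of the `j`-th kernel among the `2 * d` arguments. -/
def fstPos {d : ℕ} (j : Fin d) : Fin (2 * d) := ⟨2 * j.val, by have := j.isLt; omega⟩

/-- The position of the second argument of the `j`-th kernel among the `2 * d` arguments. -/
def sndPos {d : ℕ} (j : Fin d) : Fin (2 * d) := ⟨2 * j.val + 1, by have := j.isLt; omega⟩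

/-- The index of the kernel that a position belongs to. -/
def posCoord {d : ℕ} (p : Fin (2 * d)) : Fin d := ⟨p.val / 2, by have := p.isLt; omega⟩

@[simp] lemma posCoord_fstPos {d : ℕ} (j : Fin d) : posCoord (fstPos j) = j := by
  ext; simp only [posCoord, fstPos]; omega

@[simp] lemma posCoord_sndPos {d : ℕ} (j : Fin d) : posCoord (sndPos j) = j := by
  ext; simp only [posCoord, sndPos]; omega

lemma eq_fstPos_or_eq_sndPos {d : ℕ} (p : Fin (2 * d)) :
    p = fstPos (posCoord p) ∨ p = sndPos (posCoord p) := by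
  simp only [Fin.ext_iff, posCoord, fstPos, sndPos]; omega

lemma fstPos_ne_sndPos {d : ℕ} (i j : Fin d) : fstPos i ≠ sndPos j := by
  simp only [ne_eq, Fin.ext_iff, fstPos, sndPos]; omega

/-- The product of the kernels, evaluated at `2 * d` points. -/
def kernelProd {d : ℕ} {𝒳 : Fin d → Type*} (k : ∀ j, 𝒳 j → 𝒳 j → ℝ)
    (Y : Fin (2 * d) → ∀ j, 𝒳 j) : ℝ :=
  ∏ j, k j (Y (fstPos j) j) (Y (sndPos j) j)

/-- The permutation that `permAct ψ` applies to the `j`-th coordinate. -/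
def coordPerm {d n : ℕ} (ψ : Fin (d - 1) → Equiv.Perm (Fin n)) (j : Fin d) :
    Equiv.Perm (Fin n) :=
  if h : j.val = 0 then 1 else ψ ⟨j.val - 1, by have := j.isLt; omega⟩

lemma permAct_apply {d n : ℕ} {𝒳 : Fin d → Type*} (ψ : Fin (d - 1) → Equiv.Perm (Fin n))
    (D : Fin n → ∀ j, 𝒳 j) (i : Fin n) (j : Fin d) :
    permAct ψ D i j = D (coordPerm ψ j i) j := by
  unfold permAct coordPerm
  split_ifs <;> rfl

/-- The sample indices used after permuting, as a function of the position. -/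
def permIndex {d n : ℕ} (ψ : Fin (d - 1) → Equiv.Perm (Fin n)) (I : Fin (2 * d) → Fin n) :
    Fin (2 * d) → Fin n :=
  fun p => coordPerm ψ (posCoord p) (I p)

lemma kernelProd_permAct {d n : ℕ} {𝒳 : Fin d → Type*} (k : ∀ j, 𝒳 j → 𝒳 j → ℝ)
    (ψ : Fin (d - 1) → Equiv.Perm (Fin n)) (D : Fin n → ∀ j, 𝒳 j) (I : Fin (2 * d) → Fin n) :
    kernelProd k (fun p => permAct ψ D (I p)) = kernelProd k (fun p => D (permIndex ψ I p)) := by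
  simp [kernelProd, permAct_apply, permIndex]

/-! ### Counting collisions -/

lemma mul_card_filter_le_of_injOn {Ω : Type*} [Fintype Ω] {n : ℕ} (P : Ω → Prop) [DecidablePred P]
    (f : Fin n → Ω → Ω)
    (hf : ∀ c c' s s', P s → P s' → f c s = f c' s' → c = c' ∧ s = s') :
    n * (Finset.univ.filter P).card ≤ Fintype.card Ω := by
  have h := Finset.card_le_card_of_injOn (s := Finset.univ ×ˢ Finset.univ.filter P)
    (t := (Finset.univ : Finset Ω)) (fun x : Fin n × Ω => f x.1 x.2) (by simp) (by
      rintro ⟨c, s⟩ hs ⟨c', s'⟩ hs' h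
      simp only [Finset.coe_product, Set.mem_prod, Finset.mem_coe, Finset.mem_filter,
        Finset.mem_univ, true_and] at hs hs'
      obtain ⟨rfl, rfl⟩ := hf c c' s s' hs hs' h
      rfl)
  simpa [Finset.card_product] using h

lemma mul_card_coordPerm_eq_le {d n : ℕ} {j j' : Fin d} (hjj : j ≠ j') (x y : Fin n) :
    n * (Finset.univ.filter fun ψ : Fin (d - 1) → Equiv.Perm (Fin n) =>
      coordPerm ψ j x = coordPerm ψ j' y).card ≤
      Fintype.card (Fin (d - 1) → Equiv.Perm (Fin n)) := by
  wlog hj' : j'.val ≠ 0 generalizing j j' x y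
  · have hj : j.val ≠ 0 := fun h => hjj (Fin.ext (by omega))
    simpa only [eq_comm] using this hjj.symm y x hj
  set l : Fin (d - 1) := ⟨j'.val - 1, by have := j'.isLt; omega⟩ with hl
  have h1 (ψ : Fin (d - 1) → Equiv.Perm (Fin n)) : coordPerm ψ j' = ψ l := by
    simp [coordPerm, hj', hl]
  have h2 (ψ : Fin (d - 1) → Equiv.Perm (Fin n)) (π : Equiv.Perm (Fin n)) :
      coordPerm (Function.update ψ l π) j = coordPerm ψ j := by
    unfold coordPerm
    split_ifs with h
    · rfl
    · refine Function.update_of_ne ?_ _ _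
      simp only [hl, ne_eq, Fin.mk.injEq]
      intro h'
      exact hjj (Fin.ext (by omega))
  simp only [h1]
  refine mul_card_filter_le_of_injOn _
    (fun c ψ => Function.update ψ l (Equiv.swap (coordPerm ψ j x) c * ψ l)) ?_
  intro c c' ψ ψ' hψ hψ' h
  have hx : coordPerm ψ j x = coordPerm ψ' j x := by
    have := congrArg (fun ψ => coordPerm ψ j x) h
    simpa only [h2] using this
  have hll := congrFun h l
  simp only [Function.update_self] at hll
  have hc : c = c' := by
    have := congrArg (fun π : Equiv.Perm (Fin n) => π y) hll
    simpa [hψ, hψ'] using this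
  refine ⟨hc, funext fun m => ?_⟩
  by_cases hm : m = l
  · subst hm
    rw [hx, hc] at hll
    exact mul_left_cancel hll
  · have := congrFun h m
    simpa [Function.update_of_ne hm] using this

lemma mul_card_permIndex_eq_le {d n : ℕ} {A : Type*} [Fintype A] (I : A → Fin (2 * d) → Fin n)
    (hI : ∀ j, n * (Finset.univ.filter fun a => I a (fstPos j) = I a (sndPos j)).card ≤
      Fintype.card A) {p q : Fin (2 * d)} (hpq : p ≠ q) :
    n * (Finset.univ.filter fun x : (Fin (d - 1) → Equiv.Perm (Fin n)) × A =>
      permIndex x.1 (I x.2) p = permIndex x.1 (I x.2) q).card ≤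
      Fintype.card ((Fin (d - 1) → Equiv.Perm (Fin n)) × A) := by
  by_cases h : posCoord p = posCoord q
  · have key : n * (Finset.univ.filter fun a => I a p = I a q).card ≤ Fintype.card A := by
      rcases eq_fstPos_or_eq_sndPos p with hp | hp <;> rcases eq_fstPos_or_eq_sndPos q with hq | hq
      · exact absurd (hp.trans (h ▸ hq.symm)) hpq
      · rw [hp, hq, h]; exact hI _
      · rw [hp, hq, h]; simpa only [eq_comm] using hI (posCoord q)
      · exact absurd (hp.trans (h ▸ hq.symm)) hpq
    have : (Finset.univ.filter fun x : (Fin (d - 1) → Equiv.Perm (Fin n)) × A =>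
        permIndex x.1 (I x.2) p = permIndex x.1 (I x.2) q) =
        Finset.univ ×ˢ Finset.univ.filter fun a => I a p = I a q := by
      ext x; simp [permIndex, h]
    rw [this, Finset.card_product, Fintype.card_prod, Finset.card_univ, mul_left_comm]
    exact Nat.mul_le_mul_left _ key
  · simp only [Finset.card_filter, Fintype.sum_prod_type_right, Finset.mul_sum,
      Fintype.card_prod]
    rw [mul_comm (Fintype.card _), ← smul_eq_mul (Fintype.card A), ← Finset.card_univ (α := A),
      ← Finset.sum_const]
    refine Finset.sum_le_sum fun a _ => ?_
    rw [← Finset.mul_sum, ← Finset.card_filter]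
    exact mul_card_coordPerm_eq_le h _ _

lemma mul_card_not_injective_permIndex_le {d n : ℕ} {A : Type*} [Fintype A]
    (I : A → Fin (2 * d) → Fin n)
    (hI : ∀ j, n * (Finset.univ.filter fun a => I a (fstPos j) = I a (sndPos j)).card ≤
      Fintype.card A) :
    n * (Finset.univ.filter fun x : (Fin (d - 1) → Equiv.Perm (Fin n)) × A =>
      ¬ Function.Injective (permIndex x.1 (I x.2))).card ≤
      (2 * d) ^ 2 * Fintype.card ((Fin (d - 1) → Equiv.Perm (Fin n)) × A) := by
  set T : Finset (Fin (2 * d) × Fin (2 * d)) := Finset.univ.filter fun r => r.1 ≠ r.2 with hT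
  have hsub : (Finset.univ.filter fun x : (Fin (d - 1) → Equiv.Perm (Fin n)) × A =>
      ¬ Function.Injective (permIndex x.1 (I x.2))) ⊆
      T.biUnion fun r => Finset.univ.filter fun x : (Fin (d - 1) → Equiv.Perm (Fin n)) × A =>
        permIndex x.1 (I x.2) r.1 = permIndex x.1 (I x.2) r.2 := by
    intro x hx
    obtain ⟨p, q, h, hne⟩ := Function.not_injective_iff.1 (Finset.mem_filter.1 hx).2
    simp only [Finset.mem_biUnion, Finset.mem_filter, Finset.mem_univ, true_and]
    exact ⟨(p, q), by simpa [hT] using hne, h⟩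
  have hTcard : T.card ≤ (2 * d) ^ 2 := by
    refine (Finset.card_le_univ T).trans ?_
    simp [sq]
  calc _ ≤ n * ∑ r ∈ T, (Finset.univ.filter fun x : (Fin (d - 1) → Equiv.Perm (Fin n)) × A =>
        permIndex x.1 (I x.2) r.1 = permIndex x.1 (I x.2) r.2).card :=
        Nat.mul_le_mul_left _ ((Finset.card_le_card hsub).trans Finset.card_biUnion_le)
    _ ≤ T.card * Fintype.card ((Fin (d - 1) → Equiv.Perm (Fin n)) × A) := by
        rw [Finset.mul_sum]
        exact Finset.sum_le_card_nsmul _ _ _ fun r hr =>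
          mul_card_permIndex_eq_le I hI (by simpa [hT] using hr)
    _ ≤ _ := Nat.mul_le_mul_right _ hTcard

/-- A finite average of values that equal `θ` off an exceptional set is close to `θ`. -/
lemma abs_average_sub_le {Ω : Type*} [Fintype Ω] [Nonempty Ω] (P : Ω → Prop) [DecidablePred P]
    (g : Ω → ℝ) {θ C N M : ℝ} (hN : 0 < N) (hC : 0 ≤ C) (hg : ∀ x, |g x| ≤ C)
    (hP : ∀ x, P x → g x = θ)
    (hcard : N * (Finset.univ.filter fun x => ¬ P x).card ≤ M * Fintype.card Ω) :
    |(Fintype.card Ω : ℝ)⁻¹ * ∑ x, g x - θ| ≤ (C + |θ|) * M / N := by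
  have hΩ : (0 : ℝ) < Fintype.card Ω := by exact_mod_cast Fintype.card_pos
  have h1 : (Fintype.card Ω : ℝ)⁻¹ * ∑ x, g x - θ =
      (Fintype.card Ω : ℝ)⁻¹ * ∑ x, (g x - θ) := by
    rw [Finset.sum_sub_distrib, mul_sub]
    simp [hΩ.ne']
  have h2 : |∑ x, (g x - θ)| ≤ (Finset.univ.filter fun x => ¬ P x).card * (C + |θ|) := by
    rw [← nsmul_eq_mul, ← Finset.sum_const, Finset.sum_filter]
    refine (Finset.abs_sum_le_sum_abs _ _).trans (Finset.sum_le_sum fun x _ => ?_)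
    split_ifs with h
    · simp [hP x h]
    · exact (abs_sub _ _).trans (by linarith [hg x])
  rw [h1, abs_mul, abs_of_pos (inv_pos.2 hΩ), inv_mul_le_iff₀ hΩ]
  refine h2.trans ?_
  rw [← mul_div_assoc, le_div_iff₀ hN]
  have := mul_le_mul_of_nonneg_left hcard (add_nonneg hC (abs_nonneg θ))
  linarith

/-! ### Expectations of kernel products -/

lemma exists_eq_comp_injective {m n : ℕ} (h : m ≤ n) (J : Fin m → Fin n) :
    ∃ (e : Fin m → Fin n) (τ : Fin m → Fin m), Function.Injective e ∧ J = e ∘ τ := by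
  obtain ⟨s, hs, hcard⟩ := Finset.exists_superset_card_eq (s := Finset.univ.image J) (n := m)
    (by simpa using Finset.card_image_le (s := Finset.univ) (f := J)) (by simpa using h)
  have hr (p : Fin m) : ∃ q, s.orderEmbOfFin hcard q = J p := by
    have : J p ∈ Set.range (s.orderEmbOfFin hcard) := by
      rw [Finset.range_orderEmbOfFin]
      exact hs (Finset.mem_image_of_mem _ (Finset.mem_univ p))
    exact this
  choose τ hτ using hr
  exact ⟨s.orderEmbOfFin hcard, τ, (s.orderEmbOfFin hcard).injective,
    funext fun p => (hτ p).symm⟩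

lemma measurePreserving_comp_injective {E ι κ : Type*} [MeasurableSpace E] [Fintype ι] [Fintype κ]
    (μ : Measure E) [IsProbabilityMeasure μ] {e : κ → ι} (he : Function.Injective e) :
    MeasurePreserving (fun (D : ι → E) (p : κ) => D (e p))
      (Measure.pi fun _ => μ) (Measure.pi fun _ => μ) := by
  refine ⟨by fun_prop, ?_⟩
  have h := (iIndepFun_pi (μ := fun _ : ι => μ) (X := fun _ x => x)
    fun _ => aemeasurable_id).precomp he
  rw [iIndepFun_iff_map_fun_eq_pi_map (fun p => (measurable_pi_apply (e p)).aemeasurable)] at h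
  refine h.trans (congrArg Measure.pi (funext fun p => ?_))
  exact (measurePreserving_eval (fun _ : ι => μ) (e p)).map_eq

section

variable {d : ℕ} {𝒳 : Fin d → Type*} [∀ j, MeasurableSpace (𝒳 j)] {k : ∀ j, 𝒳 j → 𝒳 j → ℝ}
  {μ : Measure (∀ j, 𝒳 j)} [IsProbabilityMeasure μ]

lemma measurable_kernelProd (hk : ∀ j, Measurable (fun p : 𝒳 j × 𝒳 j => k j p.1 p.2)) :
    Measurable (kernelProd k) := by
  unfold kernelProd
  refine Finset.measurable_prod _ fun j _ => ?_
  exact (hk j).comp (f := fun Y : Fin (2 * d) → ∀ j, 𝒳 j => (Y (fstPos j) j, Y (sndPos j) j))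
    (by fun_prop)

lemma exists_forall_kernelProd_bound
    (hk : ∀ j, Measurable (fun p : 𝒳 j × 𝒳 j => k j p.1 p.2)) (hA1 : Assumption1 k μ) :
    ∃ C : ℝ, 0 ≤ C ∧ ∀ n, 2 * d ≤ n → ∀ J : Fin (2 * d) → Fin n,
      Integrable (fun D : Fin n → ∀ j, 𝒳 j => kernelProd k (fun p => D (J p)))
        (Measure.pi fun _ => μ) ∧
      |∫ D : Fin n → ∀ j, 𝒳 j, kernelProd k (fun p => D (J p)) ∂(Measure.pi fun _ => μ)| ≤ C := by
  obtain ⟨C, hC⟩ := hA1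
  refine ⟨max C 0, le_max_right _ _, fun n hn J => ?_⟩
  obtain ⟨e, τ, he, rfl⟩ := exists_eq_comp_injective hn J
  have hmk := measurable_kernelProd hk
  have hmp := measurePreserving_comp_injective μ he
  have hmτ : Measurable fun Y : Fin (2 * d) → ∀ j, 𝒳 j => kernelProd k (fun p => Y (τ p)) :=
    hmk.comp (by fun_prop)
  have hle : ∫⁻ D : Fin n → ∀ j, 𝒳 j, ‖kernelProd k (fun p => D ((e ∘ τ) p))‖ₑ
      ∂(Measure.pi fun _ => μ) ≤ ENNReal.ofReal C := by
    have h := hC τ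
    rw [Measure.restrict_univ] at h
    refine le_trans (le_of_eq ?_) h
    simp only [Real.enorm_eq_ofReal_abs]
    exact hmp.lintegral_comp hmτ.abs.ennreal_ofReal
  have hJint : Integrable (fun D : Fin n → ∀ j, 𝒳 j => kernelProd k (fun p => D ((e ∘ τ) p)))
      (Measure.pi fun _ => μ) :=
    ⟨(hmk.comp (by fun_prop)).aestronglyMeasurable, hle.trans_lt ENNReal.ofReal_lt_top⟩
  refine ⟨hJint, ?_⟩
  have h := (enorm_integral_le_lintegral_enorm _).trans hle
  rw [Real.enorm_eq_ofReal_abs] at h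
  exact (ENNReal.ofReal_le_ofReal_iff (le_max_right _ _)).1
    (h.trans (ENNReal.ofReal_le_ofReal (le_max_left _ _)))

lemma integral_kernelProd_comp_injective
    (hk : ∀ j, Measurable (fun p : 𝒳 j × 𝒳 j => k j p.1 p.2)) {n : ℕ}
    {J : Fin (2 * d) → Fin n} (hJ : Function.Injective J) :
    ∫ D : Fin n → ∀ j, 𝒳 j, kernelProd k (fun p => D (J p)) ∂(Measure.pi fun _ => μ) =
      ∫ Y, kernelProd k Y ∂(Measure.pi fun _ => μ) := by
  have hmp := measurePreserving_comp_injective μ hJ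
  rw [← hmp.map_eq, integral_map hmp.measurable.aemeasurable
    (measurable_kernelProd hk).aestronglyMeasurable]

end

instance inst_s8 (n : ℕ) : IsProbabilityMeasure (uniformPerm n) :=
  inferInstanceAs (IsProbabilityMeasure (PMF.toMeasure _))

lemma pi_uniformPerm_real_singleton {m n : ℕ} (ψ : Fin m → Equiv.Perm (Fin n)) :
    (Measure.pi fun _ : Fin m => uniformPerm n).real {ψ} =
      (Fintype.card (Fin m → Equiv.Perm (Fin n)) : ℝ)⁻¹ := by
  simp [Measure.real, Measure.pi_singleton, uniformPerm]

lemma integrable_and_integral_prod_pi_uniformPerm {E : Type*} [MeasurableSpace E]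
    (ρ : Measure E) [IsProbabilityMeasure ρ] {m n : ℕ}
    (f : E → (Fin m → Equiv.Perm (Fin n)) → ℝ) (hf : ∀ ψ, Measurable fun x => f x ψ)
    (hJint : ∀ ψ, Integrable (fun x => f x ψ) ρ) :
    Integrable (fun ω : E × (Fin m → Equiv.Perm (Fin n)) => f ω.1 ω.2)
        (ρ.prod (Measure.pi fun _ => uniformPerm n)) ∧
      ∫ ω, f ω.1 ω.2 ∂(ρ.prod (Measure.pi fun _ : Fin m => uniformPerm n)) =
        (Fintype.card (Fin m → Equiv.Perm (Fin n)) : ℝ)⁻¹ * ∑ ψ, ∫ x, f x ψ ∂ρ := by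
  have hm : Measurable (fun ω : E × (Fin m → Equiv.Perm (Fin n)) => f ω.1 ω.2) :=
    measurable_from_prod_countable_left hf
  have h : Integrable (fun ω : E × (Fin m → Equiv.Perm (Fin n)) => f ω.1 ω.2)
      (ρ.prod (Measure.pi fun _ => uniformPerm n)) :=
    (integrable_prod_iff' hm.aestronglyMeasurable).2
      ⟨Eventually.of_forall hJint, Integrable.of_finite⟩
  refine ⟨h, ?_⟩
  rw [integral_prod_symm _ h, integral_fintype Integrable.of_finite, Finset.mul_sum]
  simp only [pi_uniformPerm_real_singleton, smul_eq_mul]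

/-- If two positions of the same kernel rarely share their index, the expectation of the average
of the kernel products over a family of index choices is within `O(1 / n)` of its value at
`2 * d` independent points. -/
lemma integrable_and_abs_integral_average_sub_le {d : ℕ} {𝒳 : Fin d → Type*}
    [∀ j, MeasurableSpace (𝒳 j)] {k : ∀ j, 𝒳 j → 𝒳 j → ℝ}
    (hk : ∀ j, Measurable (fun p : 𝒳 j × 𝒳 j => k j p.1 p.2))
    {μ : Measure (∀ j, 𝒳 j)} [IsProbabilityMeasure μ] {C : ℝ} (hC : 0 ≤ C) {n : ℕ} (hn : 0 < n)
    (hbound : ∀ J : Fin (2 * d) → Fin n,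
      Integrable (fun D : Fin n → ∀ j, 𝒳 j => kernelProd k (fun p => D (J p)))
        (Measure.pi fun _ => μ) ∧
      |∫ D : Fin n → ∀ j, 𝒳 j, kernelProd k (fun p => D (J p)) ∂(Measure.pi fun _ => μ)| ≤ C)
    {A : Type*} [Fintype A] [Nonempty A] (I : A → Fin (2 * d) → Fin n)
    (hI : ∀ j, n * (Finset.univ.filter fun a => I a (fstPos j) = I a (sndPos j)).card ≤
      Fintype.card A) :
    Integrable (fun ω : (Fin n → ∀ j, 𝒳 j) × (Fin (d - 1) → Equiv.Perm (Fin n)) =>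
        (Fintype.card A : ℝ)⁻¹ * ∑ a, kernelProd k (fun p => permAct ω.2 ω.1 (I a p)))
        ((Measure.pi fun _ => μ).prod (Measure.pi fun _ => uniformPerm n)) ∧
      |∫ ω : (Fin n → ∀ j, 𝒳 j) × (Fin (d - 1) → Equiv.Perm (Fin n)),
        (Fintype.card A : ℝ)⁻¹ * ∑ a, kernelProd k (fun p => permAct ω.2 ω.1 (I a p))
        ∂((Measure.pi fun _ => μ).prod (Measure.pi fun _ => uniformPerm n)) -
        ∫ Y, kernelProd k Y ∂(Measure.pi fun _ => μ)| ≤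
        (C + |∫ Y, kernelProd k Y ∂(Measure.pi fun _ => μ)|) * (2 * d) ^ 2 / n := by
  simp only [kernelProd_permAct]
  have hmk := measurable_kernelProd hk
  obtain ⟨h1, h2⟩ := integrable_and_integral_prod_pi_uniformPerm
    (Measure.pi fun _ : Fin n => μ) (m := d - 1) (n := n)
    (fun D ψ => (Fintype.card A : ℝ)⁻¹ *
      ∑ a, kernelProd k (fun p => D (permIndex ψ (I a) p)))
    (fun ψ => (Finset.measurable_sum _ fun a _ => hmk.comp (by fun_prop)).const_mul _)
    (fun ψ => (integrable_finsetSum _ fun a _ => (hbound _).1).const_mul _)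
  refine ⟨h1, ?_⟩
  have h3 : (Fintype.card (Fin (d - 1) → Equiv.Perm (Fin n)) : ℝ)⁻¹ *
      ∑ ψ, ∫ D : Fin n → ∀ j, 𝒳 j, (Fintype.card A : ℝ)⁻¹ *
        ∑ a, kernelProd k (fun p => D (permIndex ψ (I a) p)) ∂(Measure.pi fun _ => μ) =
      (Fintype.card ((Fin (d - 1) → Equiv.Perm (Fin n)) × A) : ℝ)⁻¹ *
        ∑ x : (Fin (d - 1) → Equiv.Perm (Fin n)) × A, ∫ D : Fin n → ∀ j, 𝒳 j,
          kernelProd k (fun p => D (permIndex x.1 (I x.2) p)) ∂(Measure.pi fun _ => μ) := by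
    rw [Fintype.card_prod, Fintype.sum_prod_type, Nat.cast_mul, mul_inv, mul_assoc]
    congr 1
    rw [Finset.mul_sum]
    refine Finset.sum_congr rfl fun ψ _ => ?_
    rw [integral_const_mul, integral_finsetSum _ fun a _ => (hbound _).1]
  rw [h2, h3]
  refine abs_average_sub_le (fun x => Function.Injective (permIndex x.1 (I x.2))) _
    (by exact_mod_cast hn) hC (fun x => (hbound _).2)
    (fun x hx => integral_kernelProd_comp_injective hk hx) ?_
  exact_mod_cast mul_card_not_injective_permIndex_le I hI

/-! ### The three families of index choices -/

/-- The indices of the first sum of `dHSIC`. -/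
def pairIndex (d : ℕ) {n : ℕ} (i : Fin n × Fin n) (p : Fin (2 * d)) : Fin n :=
  if p.val % 2 = 0 then i.1 else i.2

/-- The indices of the third sum of `dHSIC`. -/
def starIndex {d n : ℕ} (i : Fin (d + 1) → Fin n) (p : Fin (2 * d)) : Fin n :=
  if p.val % 2 = 0 then i 0 else i (posCoord p).succ

@[simp] lemma pairIndex_fstPos {d n : ℕ} (i : Fin n × Fin n) (j : Fin d) :
    pairIndex d i (fstPos j) = i.1 := by
  simp [pairIndex, fstPos]

@[simp] lemma pairIndex_sndPos {d n : ℕ} (i : Fin n × Fin n) (j : Fin d) :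
    pairIndex d i (sndPos j) = i.2 := by
  simp [pairIndex, sndPos, Nat.add_mod]

@[simp] lemma starIndex_fstPos {d n : ℕ} (i : Fin (d + 1) → Fin n) (j : Fin d) :
    starIndex i (fstPos j) = i 0 := by
  simp [starIndex, fstPos]

@[simp] lemma starIndex_sndPos {d n : ℕ} (i : Fin (d + 1) → Fin n) (j : Fin d) :
    starIndex i (sndPos j) = i j.succ := by
  have h : (sndPos j).val % 2 ≠ 0 := by simp only [sndPos]; omega
  rw [starIndex, if_neg h, posCoord_sndPos]

lemma mul_card_prod_eq_le (n : ℕ) :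
    n * (Finset.univ.filter fun i : Fin n × Fin n => i.1 = i.2).card ≤
      Fintype.card (Fin n × Fin n) :=
  mul_card_filter_le_of_injOn _ (fun c i => (i.1, c)) (by
    rintro c c' ⟨a, b⟩ ⟨a', b'⟩ h h' heq
    simp_all)

lemma mul_card_apply_eq_le {ι : Type*} [Fintype ι] [DecidableEq ι] (n : ℕ) {p q : ι} (hpq : p ≠ q) :
    n * (Finset.univ.filter fun i : ι → Fin n => i p = i q).card ≤
      Fintype.card (ι → Fin n) :=
  mul_card_filter_le_of_injOn _ (fun c i => Function.update i q c) (by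
    intro c c' i i' h h' heq
    have hne (m : ι) (hm : m ≠ q) : i m = i' m := by
      have := congrFun heq m
      simpa [Function.update_of_ne hm] using this
    refine ⟨by simpa using congrFun heq q, funext fun m => ?_⟩
    by_cases hm : m = q
    · rw [hm, ← h, ← h', hne p hpq]
    · exact hne m hm)

lemma dHSIC_eq_averages {d n : ℕ} {𝒳 : Fin d → Type*} (k : ∀ j, 𝒳 j → 𝒳 j → ℝ)
    (x : Fin n → ∀ j, 𝒳 j) :
    dHSIC k x =
      (Fintype.card (Fin n × Fin n) : ℝ)⁻¹ *
        ∑ i : Fin n × Fin n, kernelProd k (fun p => x (pairIndex d i p))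
      + (Fintype.card (Fin (2 * d) → Fin n) : ℝ)⁻¹ *
        ∑ i : Fin (2 * d) → Fin n, kernelProd k (fun p => x (i p))
      - 2 * ((Fintype.card (Fin (d + 1) → Fin n) : ℝ)⁻¹ *
        ∑ i : Fin (d + 1) → Fin n, kernelProd k (fun p => x (starIndex i p))) := by
  simp only [kernelProd, pairIndex_fstPos, pairIndex_sndPos, starIndex_fstPos, starIndex_sndPos,
    Fintype.card_prod, Fintype.card_fun, Fintype.card_fin, Nat.cast_pow, ← sq,
    ← mul_assoc, inv_eq_one_div]
  simp only [mul_one_div]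
  rfl

/-- **The expectation of the dHSIC statistic of a randomly permuted sample converges
to zero.**  Under Assumption 1, with `ψ = (ψ^1, …, ψ^{d-1})` a vector of `d-1` i.i.d.
uniform permutations independent of the i.i.d. sample `D` of size `n` from `μ`
(with `μ` arbitrary), `E[dHSIĈ(ψ D)] → 0` as `n → ∞`. -/
theorem expectation_permuted_dHSIC_tendsto_zero
    {d : ℕ} (hd : 2 ≤ d)
    (𝒳 : Fin d → Type*) [∀ j, MeasurableSpace (𝒳 j)]
    (k : ∀ j, 𝒳 j → 𝒳 j → ℝ)
    (hk : ∀ j, Measurable (fun p : 𝒳 j × 𝒳 j => k j p.1 p.2))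
    (μ : Measure (∀ j, 𝒳 j)) [IsProbabilityMeasure μ]
    (hA1 : Assumption1 k μ) :
    Tendsto (fun n : ℕ =>
        ∫ ω, dHSIC k (permAct ω.2 ω.1)
          ∂((Measure.pi fun _ : Fin n => μ).prod
              (Measure.pi fun _ : Fin (d-1) => uniformPerm n)))
      atTop (nhds 0) := by
  obtain ⟨C, hC, hbound⟩ := exists_forall_kernelProd_bound hk hA1
  set K : ℝ := (C + |∫ Y, kernelProd k Y ∂(Measure.pi fun _ => μ)|) * (2 * d) ^ 2 with hK
  have hlim : Tendsto (fun n : ℕ => 4 * (K / n)) atTop (nhds 0) := by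
    simpa using (tendsto_const_div_atTop_nhds_zero_nat K).const_mul 4
  refine squeeze_zero_norm' ?_ hlim
  filter_upwards [eventually_ge_atTop (2 * d)] with n hn
  have hn0 : 0 < n := by omega
  have : Nonempty (Fin n) := ⟨⟨0, hn0⟩⟩
  obtain ⟨i1, b1⟩ := integrable_and_abs_integral_average_sub_le hk hC hn0 (hbound n hn)
    (pairIndex d) (by simpa using fun _ : Fin d => mul_card_prod_eq_le n)
  obtain ⟨i2, b2⟩ := integrable_and_abs_integral_average_sub_le hk hC hn0 (hbound n hn)
    (fun i : Fin (2 * d) → Fin n => i) (fun j => mul_card_apply_eq_le n (fstPos_ne_sndPos j j))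
  obtain ⟨i3, b3⟩ := integrable_and_abs_integral_average_sub_le hk hC hn0 (hbound n hn)
    (starIndex (d := d)) (fun j => by
      simpa only [starIndex_fstPos, starIndex_sndPos] using
        mul_card_apply_eq_le n (Fin.succ_ne_zero j).symm)
  simp only [dHSIC_eq_averages]
  rw [integral_sub (i1.fun_add i2) (i3.const_mul 2), integral_add i1 i2, integral_const_mul 2,
    Real.norm_eq_abs]
  rw [← hK] at b1 b2 b3
  rw [abs_le] at b1 b2 b3 ⊢
  constructor <;> linarith [b1.1, b1.2, b2.1, b2.2, b3.1, b3.2]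
end

section
/- If each kernel k^j : 𝒳^j × 𝒳^j → ℝ is positive semidefinite, then for every n ≥ 1 and every dataset (x_1, …, x_n) ∈ 𝒳^n, the statistic dHSIĈ(x_1, …, x_n) is nonnegative. -/
open scoped ENNReal Classical

/-- A kernel is positive semidefinite if it is symmetric and all its Gram matrices are
positive semidefinite. -/
def IsPSDKernel {α : Type*} (k : α → α → ℝ) : Prop :=
  (∀ x y, k x y = k y x) ∧
    ∀ (m : ℕ) (x : Fin m → α) (c : Fin m → ℝ),
      0 ≤ ∑ a : Fin m, ∑ b : Fin m, c a * c b * k (x a) (x b)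

open Matrix in
/-- Finite Hadamard products of real positive semidefinite matrices are positive semidefinite. -/
theorem Matrix.PosSemidef.hadamard_prod {ι κ : Type*} [Fintype κ] (s : Finset ι)
    {M : ι → Matrix κ κ ℝ} (hM : ∀ i ∈ s, (M i).PosSemidef) :
    (Matrix.of fun a b => ∏ i ∈ s, M i a b).PosSemidef := by
  induction s using Finset.induction_on with
  | empty =>
    have h := posSemidef_vecMulVec_self_star (fun _ : κ => (1 : ℝ))
    convert h using 1
    ext a b
    simp [vecMulVec_apply]
  | insert i s hi ih =>
    have h := (hM i (Finset.mem_insert_self i s)).hadamard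
      (ih fun j hj => hM j (Finset.mem_insert_of_mem hj))
    have heq : (of fun a b => ∏ j ∈ insert i s, M j a b) =
        M i ⊙ of fun a b => ∏ j ∈ s, M j a b := by
      ext a b
      simp [Finset.prod_insert hi]
    rw [heq]
    exact h

/-- The Gram matrix of a positive semidefinite kernel is positive semidefinite. -/
theorem IsPSDKernel.posSemidef_gram {α : Type*} {k : α → α → ℝ} (hk : IsPSDKernel k) {n : ℕ}
    (x : Fin n → α) : (Matrix.of fun a b => k (x a) (x b)).PosSemidef := by
  refine Matrix.PosSemidef.of_dotProduct_mulVec_nonneg ?_ fun c => ?_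
  · ext a b
    simp [hk.1 (x b) (x a)]
  · refine (hk.2 n x c).trans_eq ?_
    simp only [dotProduct, Matrix.mulVec, Finset.mul_sum, Pi.star_apply, star_trivial,
      Matrix.of_apply]
    exact Finset.sum_congr rfl fun a _ => Finset.sum_congr rfl fun b _ => by ring

/-- The Gram matrix of the points `x a` together with their empirical mean embedding, the latter
being indexed by `none`. -/
noncomputable def meanGram {n : ℕ} (K : Fin n → Fin n → ℝ) :
    Matrix (Option (Fin n)) (Option (Fin n)) ℝ :=
  Matrix.of fun
    | some a, some b => K a b
    | some a, none => (n : ℝ)⁻¹ * ∑ b, K a b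
    | none, some b => (n : ℝ)⁻¹ * ∑ a, K a b
    | none, none => ((n : ℝ) ^ 2)⁻¹ * ∑ p : Fin n × Fin n, K p.1 p.2

theorem posSemidef_meanGram {n : ℕ} {K : Fin n → Fin n → ℝ} (hK : (Matrix.of K).PosSemidef) :
    (meanGram K).PosSemidef := by
  let E : Matrix (Option (Fin n)) (Fin n) ℝ :=
    Matrix.of fun o i => o.elim (n : ℝ)⁻¹ fun a => if a = i then 1 else 0
  convert hK.mul_mul_conjTranspose_same E using 1
  ext (_ | a) (_ | b)
  · simp only [meanGram, E, Matrix.mul_apply, Matrix.of_apply, Matrix.conjTranspose_apply,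
      Option.elim, star_trivial, Fintype.sum_prod_type_right, Finset.mul_sum, Finset.sum_mul]
    exact Finset.sum_congr rfl fun b _ => Finset.sum_congr rfl fun a _ => by ring
  · simp [meanGram, E, Matrix.mul_apply, Finset.mul_sum]
  · simp [meanGram, E, Matrix.mul_apply, Finset.sum_mul, mul_comm (n : ℝ)⁻¹]
  · simp [meanGram, E, Matrix.mul_apply]

/-- Splitting a tuple of length `2 * d` into `d` consecutive pairs. -/
def pairsEquiv (d : ℕ) (α : Type*) : (Fin (2 * d) → α) ≃ (Fin d → α × α) where
  toFun i j := (i ⟨2 * j.val, by omega⟩, i ⟨2 * j.val + 1, by omega⟩)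
  invFun g m := if m.val % 2 = 0 then (g ⟨m.val / 2, by omega⟩).1 else (g ⟨m.val / 2, by omega⟩).2
  left_inv i := by
    funext m
    dsimp only
    split_ifs with h <;> congr 1 <;> ext <;> dsimp only <;> omega
  right_inv g := by
    funext j
    have h : (2 * j.val + 1) / 2 = j.val := by omega
    ext <;> simp [h, Nat.add_mod]

theorem sum_prod_pairs {d n : ℕ} (K : Fin d → Fin n → Fin n → ℝ) :
    ∑ i : Fin (2 * d) → Fin n, ∏ j : Fin d,
      K j (i ⟨2 * j.val, by omega⟩) (i ⟨2 * j.val + 1, by omega⟩) =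
    ∏ j, ∑ p : Fin n × Fin n, K j p.1 p.2 := by
  rw [Fintype.prod_sum]
  exact Fintype.sum_equiv (pairsEquiv d (Fin n)) _ _ fun _ => rfl

theorem sum_prod_succ {d n : ℕ} (K : Fin d → Fin n → Fin n → ℝ) :
    ∑ i : Fin (d + 1) → Fin n, ∏ j : Fin d, K j (i 0) (i j.succ) =
    ∑ a, ∏ j, ∑ b, K j a b := by
  simp_rw [Fintype.prod_sum]
  rw [← Fintype.sum_prod_type']
  exact Fintype.sum_equiv (Fin.consEquiv fun _ => Fin n).symm _ _ fun _ => rfl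

/-- **Nonnegativity of the dHSIC statistic.**  If each kernel `k^j` is positive
semidefinite, then for every `n ≥ 1` and every dataset `(x_1, …, x_n)` the statistic
`dHSIĈ(x_1, …, x_n)` is nonnegative. -/
theorem dHSIC_nonneg
    {d : ℕ} (hd : 2 ≤ d)
    (𝒳 : Fin d → Type*)
    (k : ∀ j, 𝒳 j → 𝒳 j → ℝ)
    (hpsd : ∀ j, IsPSDKernel (k j))
    (n : ℕ) (hn : 1 ≤ n)
    (x : Fin n → ∀ j, 𝒳 j) :
    0 ≤ dHSIC k x := by
  let K : Fin d → Fin n → Fin n → ℝ := fun j a b => k j (x a j) (x b j)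
  have hsymm : ∀ j a b, K j a b = K j b a := fun j a b => (hpsd j).1 _ _
  have hM := Matrix.PosSemidef.hadamard_prod Finset.univ (M := fun j => meanGram (K j)) fun j _ =>
    posSemidef_meanGram ((hpsd j).posSemidef_gram fun a => x a j)
  have h := hM.dotProduct_mulVec_nonneg fun o => o.elim (-1) fun _ => (n : ℝ)⁻¹
  have hpairs := sum_prod_pairs K
  have hsucc := sum_prod_succ K
  have hcol : ∀ j b, ∑ a, K j a b = ∑ a, K j b a := fun j b =>
    Finset.sum_congr rfl fun a _ => hsymm j a b
  simp only [dotProduct, Matrix.mulVec, Fintype.sum_option, Matrix.of_apply, meanGram,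
    Option.elim, star_trivial, Pi.star_apply, hcol, Finset.prod_mul_distrib, Finset.prod_const,
    Finset.card_univ, Fintype.card_fin, ← Finset.sum_mul, ← Finset.mul_sum,
    Finset.sum_add_distrib] at h
  rw [← hpairs, ← hsucc, ← Fintype.sum_prod_type'] at h
  refine h.trans_eq ?_
  simp only [dHSIC, K]
  ring
end
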